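/- With the star-shaped quiver data fixed, let (γ_{i,j}) and (γ'_{i,j}) be two families of homomorphisms 𝔽_q^× → ℂ^× (for the same block sizes n_{i,j}), with associated tuples σ and σ'. If H*_{σ,α} = H*_{σ',α}, then (1/|GL_n(𝔽_q)|) · Σ_{h} Λ_m(h) · ∏_{i=1}^k R(γ_i)(h) = (1/|GL_n(𝔽_q)|) · Σ_{h} Λ_m(h) · ∏_{i=1}^k R(γ'_i)(h); in other words, the multiplicity depends on the characters only through the set H*_{σ,α}. -/

import Mathlib

open Matrix

namespace QRep

variable {I Ω : Type} (src tgt : Ω → I)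

/-- A representation of the quiver with arrow set `Ω`, tail map `src`, head map `tgt`,
of dimension vector `β`, over the field `K`: a matrix of size `β (tgt a) × β (src a)`
for every arrow `a`. -/
def Rep (K : Type) [Field K] (β : I → ℕ) : Type :=
  ∀ a : Ω, Matrix (Fin (β (tgt a))) (Fin (β (src a))) K

/-- Isomorphism of representations (of possibly different dimension vectors). -/
def RepIso {K : Type} [Field K] {β γ : I → ℕ} (x : Rep src tgt K β) (y : Rep src tgt K γ) :
    Prop :=
  ∃ e : ∀ i, (Fin (β i) → K) ≃ₗ[K] (Fin (γ i) → K),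
    ∀ a : Ω, (Matrix.mulVecLin (y a)).comp (e (src a) : (Fin (β (src a)) → K) →ₗ[K] _)
      = ((e (tgt a) : (Fin (β (tgt a)) → K) →ₗ[K] _)).comp (Matrix.mulVecLin (x a))

/-- Direct sum (block diagonal) of two representations. -/
def dsum {K : Type} [Field K] {β γ : I → ℕ} (x : Rep src tgt K β) (y : Rep src tgt K γ) :
    Rep src tgt K (β + γ) :=
  fun a => Matrix.reindex finSumFinEquiv finSumFinEquiv (Matrix.fromBlocks (x a) 0 0 (y a))

/-- A representation is indecomposable if its dimension vector is nonzero and it is not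
isomorphic to a direct sum of two representations of nonzero dimension vectors. -/
def Indec {K : Type} [Field K] {β : I → ℕ} (x : Rep src tgt K β) : Prop :=
  β ≠ 0 ∧ ∀ (β₁ β₂ : I → ℕ) (y : Rep src tgt K β₁) (z : Rep src tgt K β₂),
    β₁ ≠ 0 → β₂ ≠ 0 → ¬ RepIso src tgt x (dsum src tgt y z)

/-- Base change of a representation along a ring homomorphism of fields. -/
def baseChange {K L : Type} [Field K] [Field L] (f : K →+* L) {β : I → ℕ}
    (x : Rep src tgt K β) : Rep src tgt L β :=
  fun a => (x a).map f

/-- `x` is of level at most `V`: every indecomposable direct summand of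
`x ⊗ K̄` has dimension vector belonging to `V`. -/
def LevelAtMost {K : Type} [Field K] {β : I → ℕ} (x : Rep src tgt K β)
    (V : Set (I → ℕ)) : Prop :=
  ∀ (γ δ : I → ℕ) (Y : Rep src tgt (AlgebraicClosure K) γ)
    (z : Rep src tgt (AlgebraicClosure K) δ), Indec src tgt Y →
    RepIso src tgt (baseChange src tgt (algebraMap K (AlgebraicClosure K)) x)
      (dsum src tgt Y z) → γ ∈ V

/-- The action of `GL_β(K)` on representations of dimension vector `β`. -/
def glAct {K : Type} [Field K] {β : I → ℕ} (g : ∀ i, GL (Fin (β i)) K)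
    (x : Rep src tgt K β) : Rep src tgt K β :=
  fun a => ((g (tgt a) : Matrix (Fin (β (tgt a))) (Fin (β (tgt a))) K) * x a) *
    (((g (src a))⁻¹ : GL (Fin (β (src a))) K) : Matrix (Fin (β (src a))) (Fin (β (src a))) K)

/-- The number of `GL_β(K)`-orbits of representations of dimension vector `β`
satisfying the property `P`. -/
noncomputable def orbitCount {K : Type} [Field K] (β : I → ℕ)
    (P : Rep src tgt K β → Prop) : ℕ :=
  Nat.card (Quot fun x y : {x : Rep src tgt K β // P x} =>
    ∃ g : ∀ i, GL (Fin (β i)) K, glAct src tgt g x.1 = y.1)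


open scoped Classical

/-- Apply a character `χ : 𝔽_q^× → ℂ^×` to a field element (0 outside the units). -/
noncomputable def χap {F : Type} [Field F] (χ : Fˣ →* ℂˣ) (d : F) : ℂ :=
  if h : d = 0 then 0 else χ (Units.mk0 d h)

/-- The determinant of the endomorphism induced by `T` on the subquotient `W / (U ∩ W)`
(defined to be `0` if `T` does not preserve `W` and `U`). -/
noncomputable def quotDet {F M : Type} [Field F] [AddCommGroup M] [Module F M]
    (T : M →ₗ[F] M) (W U : Submodule F M) : F :=
  if h : (∀ x ∈ W, T x ∈ W) ∧ (∀ x ∈ U, T x ∈ U) then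
    LinearMap.det (Submodule.mapQ (U.comap W.subtype) (U.comap W.subtype) (T.restrict h.1)
      (fun x hx => by
        simpa only [Submodule.mem_comap, LinearMap.restrict_apply, Submodule.subtype_apply]
          using h.2 x.1 hx))
  else 0

/-- The Harish-Chandra induced character of the linear character `γ` of the Levi
`GL_{n_0} × ⋯ × GL_{n_l}` of `GL_n(𝔽_q)`, evaluated at `g`: the sum over all `g`-stable
flags `𝔽_q^n = V_0 ⊇ V_1 ⊇ ⋯` with `dim V_j = β j`, of `∏_{j=0}^{l} γ_j(det(ḡ_j))`,
where `ḡ_j` is the automorphism induced by `g` on `V_j / V_{j+1}`. -/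
noncomputable def HC (F : Type) [Field F] (n l : ℕ) (β : ℕ → ℕ) (γ : ℕ → (Fˣ →* ℂˣ))
    (g : GL (Fin n) F) : ℂ :=
  ∑ᶠ V : {V : ℕ → Submodule F (Fin n → F) //
      V 0 = ⊤ ∧ (∀ j, V (j + 1) ≤ V j) ∧ (∀ j, Module.finrank F (V j) = β j) ∧
      (∀ j, ∀ v ∈ V j, Matrix.mulVecLin (g : Matrix (Fin n) (Fin n) F) v ∈ V j)},
    ∏ j ∈ Finset.range (l + 1),
      χap (γ j) (quotDet (Matrix.mulVecLin (g : Matrix (Fin n) (Fin n) F))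
        (V.1 j) (V.1 (j + 1)))

/-- The number of `m`-tuples of `n × n` matrices commuting with `g`; i.e. the character
of the conjugation action of `GL_n(𝔽_q)` on `𝔤𝔩_n(𝔽_q)^m`. -/
noncomputable def Λcount (F : Type) [Field F] (n m : ℕ) (g : GL (Fin n) F) : ℕ :=
  Nat.card {A : Fin m → Matrix (Fin n) (Fin n) F //
    ∀ r, (g : Matrix (Fin n) (Fin n) F) * A r = A r * (g : Matrix (Fin n) (Fin n) F)}


/-- Vertices of the star-shaped quiver: `none` is the central vertex `0`, and
`some ⟨i, j⟩` is the vertex `[i, j+1]` on leg `i` (so `j : Fin (s i)` runs through the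
leg vertices `[i,1], …, [i, s_i]`). -/
abbrev StarV (k : ℕ) (s : Fin k → ℕ) := Option ((i : Fin k) × Fin (s i))

/-- Arrows of the star-shaped quiver: `m` loops at the central vertex together with, for
each leg `i` and each `j`, one arrow `[i, j+1] → [i, j]`. -/
abbrev StarA (k m : ℕ) (s : Fin k → ℕ) := Fin m ⊕ ((i : Fin k) × Fin (s i))

/-- The vertex `[i, j]` preceding `[i, j+1]` on a leg (the central vertex if `j = 0`). -/
def legPrev (k : ℕ) (s : Fin k → ℕ) (a : (i : Fin k) × Fin (s i)) : StarV k s :=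
  if h : a.2.1 = 0 then none
  else some ⟨a.1, ⟨a.2.1 - 1, lt_of_le_of_lt (Nat.pred_le _) a.2.2⟩⟩

/-- Tail map of the star-shaped quiver. -/
def starSrc (k m : ℕ) (s : Fin k → ℕ) : StarA k m s → StarV k s
  | .inl _ => none
  | .inr a => some a

/-- Head map of the star-shaped quiver. -/
def starTgt (k m : ℕ) (s : Fin k → ℕ) : StarA k m s → StarV k s
  | .inl _ => none
  | .inr a => legPrev k s a

/-- A dimension vector is non-increasing along each leg. -/
def NonIncr (k : ℕ) (s : Fin k → ℕ) (δ : StarV k s → ℕ) : Prop :=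
  ∀ a : (i : Fin k) × Fin (s i), δ (some a) ≤ δ (legPrev k s a)

/-- `legβ k s nn i j = n_{i,j} + n_{i,j+1} + ⋯ + n_{i,s_i}`. -/
def legβ (k : ℕ) (s : Fin k → ℕ) (nn : Fin k → ℕ → ℕ) (i : Fin k) (j : ℕ) : ℕ :=
  ∑ h ∈ Finset.Icc j (s i), nn i h

/-- The dimension vector `α`: `α_0 = n`, `α_{[i,j]} = n_{i,j} + ⋯ + n_{i,s_i}`. -/
def starα (k n : ℕ) (s : Fin k → ℕ) (nn : Fin k → ℕ → ℕ) : StarV k s → ℕ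
  | none => n
  | some a => legβ k s nn a.1 (a.2.1 + 1)

/-- The tuple `σ`: `σ_0 = ∏_i γ_{i,0}` and `σ_{[i,j]} = γ_{i,j} γ_{i,j-1}^{-1}`. -/
noncomputable def starσ (F : Type) [Field F] (k : ℕ) (s : Fin k → ℕ)
    (γ : Fin k → ℕ → (Fˣ →* ℂˣ)) : StarV k s → (Fˣ →* ℂˣ)
  | none => ∏ i, γ i 0
  | some a => γ a.1 (a.2.1 + 1) * (γ a.1 a.2.1)⁻¹


/-- The multiplicity `⟨Λ ⊗ R(γ_1) ⊗ ⋯ ⊗ R(γ_k), 1⟩ =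
(1/|GL_n(𝔽_q)|) Σ_h Λ_m(h) ∏_i R(γ_i)(h)`. -/
noncomputable def mult (F : Type) [Field F] [Fintype F] (k m n : ℕ) (s : Fin k → ℕ)
    (nn : Fin k → ℕ → ℕ) (γ : Fin k → ℕ → (Fˣ →* ℂˣ)) : ℂ :=
  (Nat.card (GL (Fin n) F) : ℂ)⁻¹ *
    ∑ᶠ h : GL (Fin n) F,
      (Λcount F n m h : ℂ) * ∏ i : Fin k, HC F n (s i) (legβ k s nn i) (γ i) h

end QRep

section

open Polynomial

theorem Matrix.det_aeval_eq_resultant_of_splits {K : Type*} [Field K] {ι : Type*} [Fintype ι]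
    [DecidableEq ι] (A : Matrix ι ι K) (f : K[X]) (hf : f.Splits) :
    (aeval A f).det = A.charpoly.resultant f := by
  by_cases h0 : f = 0
  · subst h0
    rcases isEmpty_or_nonempty ι <;> simp [Matrix.charpoly_natDegree_eq_dim]
  have key : ∀ s : Multiset K,
      (aeval A (s.map (X - C ·)).prod).det = A.charpoly.resultant (s.map (X - C ·)).prod := by
    intro s
    induction s using Multiset.induction with
    | empty => simp
    | cons a s ih =>
      have hs : (s.map (X - C ·)).prod ≠ 0 :=
        (monic_multiset_prod_of_monic _ _ fun i _ => monic_X_sub_C i).ne_zero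
      rw [Multiset.map_cons, Multiset.prod_cons, natDegree_mul (X_sub_C_ne_zero a) hs,
        resultant_mul_right _ _ _ _ le_rfl, map_mul, Matrix.det_mul, ih]
      congr 1
      have := Matrix.eval_charpoly A a
      simp only [natDegree_X_sub_C]
      rw [resultant_X_sub_C_right _ _ _ le_rfl, this, Matrix.charpoly_natDegree_eq_dim,
        ← Matrix.det_neg]
      congr 1
      simp [Matrix.scalar_apply, Matrix.algebraMap_eq_diagonal]
  have hs : (f.roots.map (X - C ·)).prod ≠ 0 :=
        (monic_multiset_prod_of_monic _ _ fun i _ => monic_X_sub_C i).ne_zero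
  have hc : C f.leadingCoeff ≠ 0 := by simpa using h0
  rw [hf.eq_prod_roots, natDegree_mul hc hs,
        resultant_mul_right _ _ _ _ le_rfl, map_mul, Matrix.det_mul, key, aeval_C,
        Matrix.algebraMap_eq_diagonal]
  simp [Matrix.charpoly_natDegree_eq_dim, Finset.card_univ]

theorem Matrix.det_aeval_eq_resultant {K : Type*} [Field K] {ι : Type*} [Fintype ι]
    [DecidableEq ι] (A : Matrix ι ι K) (f : K[X]) :
    (aeval A f).det = A.charpoly.resultant f := by
  let φ := algebraMap K (AlgebraicClosure K)
  apply φ.injective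
  rw [RingHom.map_det, ← resultant_map_map, ← Matrix.charpoly_map,
    ← natDegree_map φ (p := f), ← natDegree_map φ (p := A.charpoly), ← Matrix.charpoly_map,
    ← Matrix.det_aeval_eq_resultant_of_splits _ _ (IsAlgClosed.splits _)]
  congr 1
  change (Algebra.ofId K (AlgebraicClosure K)).mapMatrix (aeval A f) = _
  rw [← aeval_algHom_apply, aeval_map_algebraMap]
  rfl

theorem LinearMap.det_aeval_eq_resultant {K M : Type*} [Field K] [AddCommGroup M] [Module K M]
    [FiniteDimensional K M] (T : Module.End K M) (f : K[X]) :
    LinearMap.det (aeval T f) = T.charpoly.resultant f := by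
  let b := Module.finBasis K M
  rw [← LinearMap.det_toMatrix b, ← LinearMap.charpoly_toMatrix T b,
    ← Matrix.det_aeval_eq_resultant]
  congr 1
  exact (aeval_algHom_apply (LinearMap.toMatrixAlgEquiv b).toAlgHom T f).symm

theorem LinearMap.charpoly_restrict_dvd {K M : Type*} [Field K] [AddCommGroup M] [Module K M]
    [FiniteDimensional K M] (T : Module.End K M) (W : Submodule K M)
    (he : ∀ x ∈ W, T x ∈ W) : (T.restrict he).charpoly ∣ T.charpoly := by
  classical
  let bW := Module.finBasis K W
  let bQ := Module.finBasis K (M ⧸ W)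
  let b := Module.Basis.sumQuot bW bQ
  have : LinearMap.toMatrix b b T = Matrix.fromBlocks (LinearMap.toMatrix bW bW (T.restrict he))
      (LinearMap.toMatrix b b T).toBlocks₁₂ 0 (LinearMap.toMatrix b b T).toBlocks₂₂ := by
    rw [← Matrix.fromBlocks_toBlocks (LinearMap.toMatrix b b T)]
    simp only [Matrix.toBlocks_fromBlocks₁₂, Matrix.toBlocks_fromBlocks₂₂]
    congr 1
    · ext i k
      simp only [Matrix.toBlocks₁₁, Matrix.of_apply, b, Module.Basis.sumQuot_inl,
        LinearMap.toMatrix_apply]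
      apply Module.Basis.sumQuot_repr_inl_of_mem
    · ext j k
      have : W.mkQ (T (bW k)) = 0 := by
        rw [← LinearMap.mem_ker, Submodule.ker_mkQ]
        exact he _ (Submodule.coe_mem (bW k))
      simp only [Matrix.toBlocks₂₁, Matrix.of_apply, b, Module.Basis.sumQuot_inl,
        LinearMap.toMatrix_apply, Module.Basis.sumQuot_repr_inr, Matrix.zero_apply]
      simpa using congrArg (fun x => bQ.repr x j) this
  rw [← LinearMap.charpoly_toMatrix T b, this, Matrix.charpoly_fromBlocks_zero₂₁,
    LinearMap.charpoly_toMatrix]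
  exact dvd_mul_right _ _

theorem AdjoinRoot.norm_mk_eq_resultant {K : Type*} [Field K] {p : K[X]} (hp : p.Monic)
    (f : K[X]) : Algebra.norm K (AdjoinRoot.mk p f) = p.resultant f := by
  let pb := AdjoinRoot.powerBasis hp.ne_zero
  have hgen : pb.gen = AdjoinRoot.root p := AdjoinRoot.powerBasis_gen hp.ne_zero
  have h : (Algebra.leftMulMatrix pb.basis (AdjoinRoot.root p)).charpoly = p := by
    rw [← hgen, charpoly_leftMulMatrix, hgen, AdjoinRoot.minpoly_root hp.ne_zero]
    simp [hp.leadingCoeff]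
  rw [Algebra.norm_eq_matrix_det pb.basis]
  conv_rhs => rw [← h, ← Matrix.det_aeval_eq_resultant]
  rw [aeval_algHom_apply, AdjoinRoot.aeval_eq]

open scoped Classical

open UniqueFactorizationMonoid in
theorem Polynomial.Monic.resultant_eq_prod_normalizedFactors {K : Type*} [Field K]
    {P : K[X]} (hP : P.Monic) (f : K[X]) (S : Finset K[X])
    (hS : (normalizedFactors P).toFinset ⊆ S) (hmon : ∀ p ∈ S, p.Monic) :
    P.resultant f = ∏ p ∈ S, p.resultant f ^ (normalizedFactors P).count p := by
  have h : P = ∏ p ∈ S, p ^ (normalizedFactors P).count p := by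
    rw [← Finset.prod_multiset_count_of_subset _ S hS, prod_normalizedFactors_eq hP.ne_zero,
      hP.normalize_eq_self]
  have hl : ∀ p ∈ S, (p ^ (normalizedFactors P).count p).leadingCoeff = 1 :=
    fun p hp => ((hmon p hp).pow _).leadingCoeff
  conv_lhs => rw [h]
  rw [resultant_prod_left _ _ _ _ (by rw [Finset.prod_congr rfl hl]; simp) le_rfl]
  exact Finset.prod_congr rfl fun p hp => resultant_pow_left _ _ _ _ (by simp [hmon p hp]) le_rfl

/-- Over a finite field, the norm to the base field from the residue field of a monic irreducible
`p` attains a prescribed nonzero value on a polynomial congruent to `1` modulo a coprime `Q`. -/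
theorem Polynomial.exists_resultant_eq {K : Type*} [Field K] [Finite K] {p Q : K[X]}
    (hp : p.Monic) (hpi : Irreducible p) (hQ : IsCoprime p Q) (c : K) :
    ∃ f : K[X], p.resultant f = c ∧ ∀ r : K[X], r.Monic → r ∣ Q → r.resultant f = 1 := by
  have : Fact (Irreducible p) := ⟨hpi⟩
  have : Module.Finite K (AdjoinRoot p) := hp.finite_adjoinRoot
  have : Finite (AdjoinRoot p) := Module.finite_of_finite K
  obtain ⟨y, hy⟩ := FiniteField.norm_surjective K (AdjoinRoot p) c
  obtain ⟨a, rfl⟩ := AdjoinRoot.mk_surjective y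
  obtain ⟨u, v, huv⟩ := hQ
  refine ⟨a * (v * Q) + u * p, ?_, fun r hr hrQ => ?_⟩
  · rw [← AdjoinRoot.norm_mk_eq_resultant hp, ← hy]
    congr 1
    rw [AdjoinRoot.mk_eq_mk]
    exact ⟨u * (1 - a), by linear_combination a * huv⟩
  · rw [← AdjoinRoot.norm_mk_eq_resultant hr]
    rw [show AdjoinRoot.mk r (a * (v * Q) + u * p) = 1 by
      rw [← map_one (AdjoinRoot.mk r), AdjoinRoot.mk_eq_mk]
      obtain ⟨w, rfl⟩ := hrQ
      exact ⟨v * w * (a - 1), by linear_combination huv⟩]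
    exact map_one _

namespace QRep

section

variable {F : Type} [Field F]

theorem χap_apply (χ : Fˣ →* ℂˣ) {d : F} (hd : d ≠ 0) : χap χ d = χ (Units.mk0 d hd) := by
  rw [χap, dif_neg hd]

theorem χap_mul_right (χ : Fˣ →* ℂˣ) (a b : F) : χap χ (a * b) = χap χ a * χap χ b := by
  by_cases ha : a = 0
  · simp [χap, ha]
  by_cases hb : b = 0
  · simp [χap, hb]
  rw [χap_apply χ ha, χap_apply χ hb, χap_apply χ (mul_ne_zero ha hb), Units.mk0_mul]
  simp

theorem χap_one_right (χ : Fˣ →* ℂˣ) : χap χ 1 = 1 := by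
  rw [χap_apply χ one_ne_zero, Units.mk0_one, map_one, Units.val_one]

theorem χap_one_left {d : F} (hd : d ≠ 0) : χap (1 : Fˣ →* ℂˣ) d = 1 := by
  simp [χap_apply _ hd]

theorem χap_ne_zero (χ : Fˣ →* ℂˣ) {d : F} (hd : d ≠ 0) : χap χ d ≠ 0 := by
  simp [χap_apply _ hd]

theorem χap_mul_left (χ ψ : Fˣ →* ℂˣ) (d : F) : χap (χ * ψ) d = χap χ d * χap ψ d := by
  by_cases hd : d = 0 <;> simp [χap, hd]

theorem χap_inv_left (χ : Fˣ →* ℂˣ) (d : F) : χap χ⁻¹ d = (χap χ d)⁻¹ := by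
  by_cases hd : d = 0 <;> simp [χap, hd]

theorem prod_χap_pow {ι : Type*} [Fintype ι] (σ : ι → (Fˣ →* ℂˣ)) (e : ι → ℕ) {d : F}
    (hd : d ≠ 0) : ∏ v, χap (σ v) (d ^ e v) = χap (∏ v, σ v ^ e v) d := by
  simp only [χap_apply _ hd, χap_apply _ (pow_ne_zero _ hd), MonoidHom.finsetProd_apply,
    Units.coe_prod, MonoidHom.pow_apply, Units.val_pow_eq_pow_val]
  refine Finset.prod_congr rfl fun v _ => ?_
  rw [← Units.val_pow_eq_pow_val, ← map_pow]
  congr 2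
  ext
  simp

theorem χap_prod_right {ι : Type*} (χ : Fˣ →* ℂˣ) (s : Finset ι) (d : ι → F) :
    χap χ (∏ i ∈ s, d i) = ∏ i ∈ s, χap χ (d i) :=
  map_prod (⟨⟨χap χ, χap_one_right χ⟩, χap_mul_right χ⟩ : F →* ℂ) d s

variable {M : Type} [AddCommGroup M] [Module F M]

/-- The determinant of the restriction of `T` to `W` (zero if `T` does not preserve `W`). -/
noncomputable def restrictDet (T : Module.End F M) (W : Submodule F M) : F :=
  if h : ∀ x ∈ W, T x ∈ W then LinearMap.det (T.restrict h) else 0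

/-- The multiplicity of `p` in the characteristic polynomial of the restriction of `T` to `W`
(zero if `T` does not preserve `W`). -/
noncomputable def restrictMult [FiniteDimensional F M] (T : Module.End F M) (W : Submodule F M)
    (p : F[X]) : ℕ :=
  if h : ∀ x ∈ W, T x ∈ W then
    (UniqueFactorizationMonoid.normalizedFactors (T.restrict h).charpoly).count p else 0

theorem coe_aeval_restrict (T : Module.End F M) (W : Submodule F M) (h : ∀ x ∈ W, T x ∈ W)
    (f : F[X]) (x : W) : ((aeval (T.restrict h : Module.End F W) f x : W) : M) = aeval T f x := by
  induction f using Polynomial.induction_on generalizing x with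
  | C a => simp
  | add p q hp hq => simp [hp, hq]
  | monomial n a ih =>
    have e : (C a * X ^ (n + 1) : F[X]) = C a * X ^ n * X := by ring
    rw [e, map_mul _ (C a * X ^ n), map_mul _ (C a * X ^ n), Module.End.mul_apply,
      Module.End.mul_apply, ih]
    simp

theorem aeval_mem (T : Module.End F M) (W : Submodule F M) (h : ∀ x ∈ W, T x ∈ W)
    (f : F[X]) : ∀ x ∈ W, aeval T f x ∈ W := fun x hx => by
  rw [← coe_aeval_restrict T W h f ⟨x, hx⟩]
  exact Subtype.property _

theorem restrictDet_mul (S T : Module.End F M) (W : Submodule F M) (hS : ∀ x ∈ W, S x ∈ W)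
    (hT : ∀ x ∈ W, T x ∈ W) : restrictDet (S * T) W = restrictDet S W * restrictDet T W := by
  have hST : ∀ x ∈ W, (S * T) x ∈ W := fun x hx => hS _ (hT x hx)
  rw [restrictDet, restrictDet, restrictDet, dif_pos hS, dif_pos hT, dif_pos hST,
    ← LinearMap.det_comp]
  rfl

theorem restrictDet_one (W : Submodule F M) : restrictDet (1 : Module.End F M) W = 1 := by
  rw [restrictDet, dif_pos (show ∀ x ∈ W, (1 : Module.End F M) x ∈ W from fun x hx => hx)]
  exact LinearMap.det_id

theorem restrictDet_eq_one_of_finrank (T : Module.End F M) {W : Submodule F M}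
    (hT : ∀ x ∈ W, T x ∈ W) (h0 : Module.finrank F W = 0) : restrictDet T W = 1 := by
  rw [restrictDet, dif_pos hT]
  exact LinearMap.det_eq_one_of_finrank_eq_zero h0 _

variable [FiniteDimensional F M]

open UniqueFactorizationMonoid in
theorem restrictDet_aeval (T : Module.End F M) (W : Submodule F M)
    (h : ∀ x ∈ W, T x ∈ W) (f : F[X]) :
    restrictDet (aeval T f) W =
      ∏ p ∈ (normalizedFactors T.charpoly).toFinset, p.resultant f ^ restrictMult T W p := by
  have hdvd := LinearMap.charpoly_restrict_dvd T W h
  rw [restrictDet, dif_pos (aeval_mem T W h f)]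
  have : (aeval T f).restrict (aeval_mem T W h f) = aeval (T.restrict h : Module.End F W) f := by
    ext x
    rw [coe_aeval_restrict]
    rfl
  rw [this, LinearMap.det_aeval_eq_resultant,
    (T.restrict h).charpoly_monic.resultant_eq_prod_normalizedFactors f
      (normalizedFactors T.charpoly).toFinset]
  · refine Finset.prod_congr rfl fun p _ => ?_
    rw [restrictMult, dif_pos h]
  · exact Multiset.toFinset_subset.2 (Multiset.subset_of_le
      ((dvd_iff_normalizedFactors_le_normalizedFactors (T.restrict h).charpoly_monic.ne_zero
        T.charpoly_monic.ne_zero).1 hdvd))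
  · exact fun p hp => ((Polynomial.mem_normalizedFactors_iff
      T.charpoly_monic.ne_zero).1 (Multiset.mem_toFinset.1 hp)).2.1

theorem restrictMult_mono (T : Module.End F M) {W W' : Submodule F M} (hle : W ≤ W')
    (h : ∀ x ∈ W, T x ∈ W) (h' : ∀ x ∈ W', T x ∈ W') (p : F[X]) :
    restrictMult T W p ≤ restrictMult T W' p := by
  rw [restrictMult, restrictMult, dif_pos h, dif_pos h']
  apply Multiset.count_le_of_le
  rw [← UniqueFactorizationMonoid.dvd_iff_normalizedFactors_le_normalizedFactors
    (LinearMap.charpoly_monic _).ne_zero (LinearMap.charpoly_monic _).ne_zero]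
  let U := W.comap W'.subtype
  have hU : ∀ x ∈ U, T.restrict h' x ∈ U := fun x hx => h _ hx
  have := LinearMap.charpoly_restrict_dvd (T.restrict h') U hU
  rwa [← LinearEquiv.charpoly_conj (Submodule.comapSubtypeEquivOfLe hle)] at this

theorem restrictMult_le_finrank (T : Module.End F M) (W : Submodule F M) {p : F[X]}
    (hp : Irreducible p) : restrictMult T W p ≤ Module.finrank F W := by
  rw [restrictMult]
  split_ifs with h
  · rw [← (T.restrict h).charpoly_natDegree]
    have hd : p ^ (UniqueFactorizationMonoid.normalizedFactors (T.restrict h).charpoly).count p ∣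
        (T.restrict h).charpoly := by
      rw [← Multiset.prod_replicate]
      exact (Multiset.prod_dvd_prod_of_le (Multiset.le_count_iff_replicate_le.1 le_rfl)).trans
        (UniqueFactorizationMonoid.prod_normalizedFactors
          (T.restrict h).charpoly_monic.ne_zero).dvd
    have := natDegree_le_of_dvd hd (T.restrict h).charpoly_monic.ne_zero
    rw [natDegree_pow] at this
    exact (Nat.le_mul_of_pos_right _ hp.natDegree_pos).trans this
  · exact Nat.zero_le _

theorem restrictMult_top_ne_zero (T : Module.End F M) {p : F[X]}
    (hp : p ∈ UniqueFactorizationMonoid.normalizedFactors T.charpoly) :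
    restrictMult T ⊤ p ≠ 0 := by
  have h : ∀ x ∈ (⊤ : Submodule F M), T x ∈ (⊤ : Submodule F M) := fun _ _ => Submodule.mem_top
  have : (T.restrict h).charpoly = T.charpoly := by
    rw [← LinearEquiv.charpoly_conj (Submodule.topEquiv (R := F) (M := M)) (T.restrict h)]
    rfl
  rw [restrictMult, dif_pos h, this]
  exact Multiset.count_ne_zero.2 hp

open UniqueFactorizationMonoid in
theorem prod_χap_restrictDet_aeval {ι : Type*} [Fintype ι] (T : Module.End F M)
    (W : ι → Submodule F M) (hW : ∀ v, ∀ x ∈ W v, T x ∈ W v) (σ : ι → (Fˣ →* ℂˣ)) (f : F[X])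
    (hf : ∀ p ∈ normalizedFactors T.charpoly, p.resultant f ≠ 0) :
    ∏ v, χap (σ v) (restrictDet (aeval T f) (W v)) =
      ∏ p ∈ (normalizedFactors T.charpoly).toFinset,
        χap (∏ v, σ v ^ restrictMult T (W v) p) (p.resultant f) := by
  simp only [fun v => restrictDet_aeval T (W v) (hW v) f, χap_prod_right]
  rw [Finset.prod_comm]
  exact Finset.prod_congr rfl fun p hp => prod_χap_pow _ _ (hf p (Multiset.mem_toFinset.1 hp))

open UniqueFactorizationMonoid in
theorem det_aeval_ne_zero_iff (T : Module.End F M) (f : F[X]) :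
    LinearMap.det (aeval T f) ≠ 0 ↔ ∀ p ∈ normalizedFactors T.charpoly, p.resultant f ≠ 0 := by
  rw [LinearMap.det_aeval_eq_resultant,
    T.charpoly_monic.resultant_eq_prod_normalizedFactors f _ subset_rfl
      (fun p hp => ((Polynomial.mem_normalizedFactors_iff
        T.charpoly_monic.ne_zero).1 (Multiset.mem_toFinset.1 hp)).2.1), Finset.prod_ne_zero_iff]
  refine forall_congr' fun p => ?_
  rw [Multiset.mem_toFinset]
  refine imp_congr_right fun hp => ?_
  rw [Ne, pow_eq_zero_iff (Multiset.count_ne_zero.2 hp)]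

open UniqueFactorizationMonoid in
theorem prod_pow_restrictMult_eq_one [Finite F] {ι : Type*} [Fintype ι] (T : Module.End F M)
    (W : ι → Submodule F M) (hW : ∀ v, ∀ x ∈ W v, T x ∈ W v) (σ : ι → (Fˣ →* ℂˣ))
    (h1 : ∀ f : F[X], LinearMap.det (aeval T f) ≠ 0 →
      ∏ v, χap (σ v) (restrictDet (aeval T f) (W v)) = 1)
    {p : F[X]} (hp : p ∈ normalizedFactors T.charpoly) :
    ∏ v, σ v ^ restrictMult T (W v) p = 1 := by
  have hS : ∀ r ∈ normalizedFactors T.charpoly, Irreducible r ∧ r.Monic := fun r hr =>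
    ((Polynomial.mem_normalizedFactors_iff T.charpoly_monic.ne_zero).1 hr).imp_right And.left
  ext c : 1
  let S := (normalizedFactors T.charpoly).toFinset
  have hpS : p ∈ S := Multiset.mem_toFinset.2 hp
  have hcop : IsCoprime p (∏ r ∈ S.erase p, r) := by
    refine IsCoprime.prod_right fun r hr => ?_
    obtain ⟨hrp, hr⟩ := Finset.mem_erase.1 hr
    have hr' := hS r (Multiset.mem_toFinset.1 hr)
    rw [(hS p hp).1.coprime_iff_not_dvd]
    exact fun hd => hrp (eq_of_monic_of_associated hr'.2 (hS p hp).2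
      ((hS p hp).1.associated_of_dvd hr'.1 hd).symm)
  obtain ⟨f, hfp, hfr⟩ := exists_resultant_eq (hS p hp).2 (hS p hp).1 hcop (c : F)
  have hfr' : ∀ r ∈ S, r ≠ p → r.resultant f = 1 := fun r hr hne =>
    hfr r (hS r (Multiset.mem_toFinset.1 hr)).2
      (Finset.dvd_prod_of_mem _ (Finset.mem_erase.2 ⟨hne, hr⟩))
  have hne : ∀ r ∈ normalizedFactors T.charpoly, r.resultant f ≠ 0 := by
    intro r hr
    by_cases hrp : r = p
    · rw [hrp, hfp]
      exact c.ne_zero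
    · rw [hfr' r (Multiset.mem_toFinset.2 hr) hrp]
      exact one_ne_zero
  have := h1 f ((det_aeval_ne_zero_iff T f).2 hne)
  rw [prod_χap_restrictDet_aeval T W hW σ f hne, Finset.prod_eq_single_of_mem p hpS
    (fun r hr hrp => by rw [hfr' r hr hrp, χap_one_right]), hfp, χap_apply _ c.ne_zero,
    Units.mk0_val] at this
  rw [MonoidHom.one_apply]
  exact Units.ext this

open UniqueFactorizationMonoid in
/-- If `σ` is trivial on the units of `F[T]` and every relation it satisfies on the primary
multiplicity vectors of `T` also holds for `σ'`, then `σ'` is trivial at `T`. -/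
theorem prod_χap_restrictDet_eq_one [Finite F] {ι : Type*} [Fintype ι] (T : Module.End F M)
    (hT : LinearMap.det T ≠ 0)
    (W : ι → Submodule F M) (hW : ∀ v, ∀ x ∈ W v, T x ∈ W v) (σ σ' : ι → (Fˣ →* ℂˣ))
    (hσ : ∀ p ∈ normalizedFactors T.charpoly, ∏ v, σ v ^ restrictMult T (W v) p = 1 →
      ∏ v, σ' v ^ restrictMult T (W v) p = 1)
    (h1 : ∀ f : F[X], LinearMap.det (aeval T f) ≠ 0 →
      ∏ v, χap (σ v) (restrictDet (aeval T f) (W v)) = 1) :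
    ∏ v, χap (σ' v) (restrictDet T (W v)) = 1 := by
  have hne := (det_aeval_ne_zero_iff T X).1 (by rwa [aeval_X])
  have := prod_χap_restrictDet_aeval T W hW σ' X hne
  rw [aeval_X] at this
  rw [this]
  refine Finset.prod_eq_one fun p hp => ?_
  rw [Multiset.mem_toFinset] at hp
  rw [hσ p hp (prod_pow_restrictMult_eq_one T W hW σ h1 hp), χap_one_left (hne p hp)]

theorem restrictDet_ne_zero {T : Module.End F M} (h : LinearMap.det T ≠ 0) {W : Submodule F M}
    (hT : ∀ x ∈ W, T x ∈ W) : restrictDet T W ≠ 0 := by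
  rw [restrictDet, dif_pos hT]
  have := LinearMap.det_eq_det_mul_det W T hT
  exact fun h0 => h (by rw [this, h0, zero_mul])

theorem restrictDet_eq_mul_quotDet (T : Module.End F M) {W U : Submodule F M}
    (hle : U ≤ W) (hW : ∀ x ∈ W, T x ∈ W) (hU : ∀ x ∈ U, T x ∈ U) :
    restrictDet T W = restrictDet T U * quotDet T W U := by
  rw [restrictDet, restrictDet, quotDet, dif_pos hW, dif_pos hU, dif_pos ⟨hW, hU⟩,
    LinearMap.det_eq_det_mul_det (U.comap W.subtype) (T.restrict hW) fun x hx => hU _ hx]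
  congr 1
  rw [← LinearMap.det_conj _ (Submodule.comapSubtypeEquivOfLe hle)]
  rfl

end


/-- Decreasing chains of subspaces of `F ^ n` starting at the whole space, with dimensions `β`. -/
abbrev Flag (F : Type) [Field F] (n : ℕ) (β : ℕ → ℕ) : Type :=
  {V : ℕ → Submodule F (Fin n → F) //
    V 0 = ⊤ ∧ (∀ j, V (j + 1) ≤ V j) ∧ ∀ j, Module.finrank F (V j) = β j}

section

variable {F : Type} [Field F] {n : ℕ}

/-- All members of a flag are preserved by `g`. -/
def Flag.IsStable {β : ℕ → ℕ} (V : Flag F n β) (g : GL (Fin n) F) : Prop :=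
  ∀ j, ∀ v ∈ V.1 j, Matrix.mulVecLin (g : Matrix (Fin n) (Fin n) F) v ∈ V.1 j

theorem det_mulVecLin_ne_zero (g : GL (Fin n) F) :
    LinearMap.det (Matrix.mulVecLin (g : Matrix (Fin n) (Fin n) F)) ≠ 0 := by
  have := LinearMap.det_toLin' (g : Matrix (Fin n) (Fin n) F)
  rw [Matrix.toLin'_apply'] at this
  rw [this]
  exact g.det_ne_zero

theorem Flag.finite [Finite F] {β : ℕ → ℕ} {l : ℕ} (hβ : ∀ j, l < j → β j = 0) :
    Finite (Flag F n β) := by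
  refine Finite.of_injective (fun V : Flag F n β => fun j : Fin (l + 1) => V.1 j) ?_
  intro V V' h
  ext1
  funext j
  by_cases hj : j < l + 1
  · exact congrFun h ⟨j, hj⟩
  · have h0 := hβ j (by lia)
    rw [Submodule.finrank_eq_zero.1 ((V.2.2.2 j).trans h0),
      Submodule.finrank_eq_zero.1 ((V'.2.2.2 j).trans h0)]

theorem HC_eq_sum {β : ℕ → ℕ} [Fintype (Flag F n β)] (l : ℕ) (γ : ℕ → (Fˣ →* ℂˣ))
    (g : GL (Fin n) F) :
    HC F n l β γ g = ∑ V : Flag F n β, if V.IsStable g then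
      ∏ j ∈ Finset.range (l + 1),
        χap (γ j) (quotDet (Matrix.mulVecLin (g : Matrix (Fin n) (Fin n) F))
          (V.1 j) (V.1 (j + 1))) else 0 := by
  rw [← Finset.sum_filter, Finset.sum_subtype (p := fun V : Flag F n β => V.IsStable g) _
    (by simp), ← finsum_eq_sum_of_fintype, HC]
  refine finsum_eq_of_bijective
    (fun V => ⟨⟨V.1, V.2.1, V.2.2.1, V.2.2.2.1⟩, V.2.2.2.2⟩) ⟨?_, ?_⟩ fun V => rfl
  · exact fun V V' h => Subtype.ext (congrArg (fun W => W.1.1) h)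
  · rintro ⟨⟨V, h1, h2, h3⟩, h4⟩
    exact ⟨⟨V, h1, h2, h3, h4⟩, rfl⟩

theorem Flag.prod_χap_quotDet {β : ℕ → ℕ} (V : Flag F n β) {l : ℕ} (hβ : β (l + 1) = 0)
    (γ : ℕ → (Fˣ →* ℂˣ)) {g : GL (Fin n) F} (hg : V.IsStable g) :
    ∏ j ∈ Finset.range (l + 1),
        χap (γ j) (quotDet (Matrix.mulVecLin (g : Matrix (Fin n) (Fin n) F))
          (V.1 j) (V.1 (j + 1))) =
      χap (γ 0) (restrictDet (Matrix.mulVecLin (g : Matrix (Fin n) (Fin n) F)) ⊤) *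
        ∏ j ∈ Finset.range l, χap (γ (j + 1) * (γ j)⁻¹)
          (restrictDet (Matrix.mulVecLin (g : Matrix (Fin n) (Fin n) F)) (V.1 (j + 1))) := by
  set T := Matrix.mulVecLin (g : Matrix (Fin n) (Fin n) F) with hT
  have hd : ∀ j, restrictDet T (V.1 j) ≠ 0 := fun j =>
    restrictDet_ne_zero (det_mulVecLin_ne_zero g) (hg j)
  have hq : ∀ j, χap (γ j) (quotDet T (V.1 j) (V.1 (j + 1))) =
      χap (γ j) (restrictDet T (V.1 j)) / χap (γ j) (restrictDet T (V.1 (j + 1))) := fun j => by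
    rw [eq_div_iff (χap_ne_zero _ (hd _)), ← χap_mul_right, mul_comm,
      ← restrictDet_eq_mul_quotDet T (V.2.2.1 j) (hg j) (hg (j + 1))]
  simp only [hq, χap_mul_left, χap_inv_left, Finset.prod_div_distrib, ← div_eq_mul_inv]
  rw [Finset.prod_range_succ', Finset.prod_range_succ (fun j =>
      χap (γ j) (restrictDet T (V.1 (j + 1)))),
    restrictDet_eq_one_of_finrank T (hg (l + 1)) ((V.2.2.2 _).trans hβ), χap_one_right, mul_one,
    V.2.1]
  ring

theorem Λcount_eq_sum [Fintype F] (m : ℕ) (g : GL (Fin n) F) :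
    (Λcount F n m g : ℂ) = ∑ A : Fin m → Matrix (Fin n) (Fin n) F,
      if ∀ r, (g : Matrix (Fin n) (Fin n) F) * A r = A r * (g : Matrix (Fin n) (Fin n) F)
        then 1 else 0 := by
  rw [Finset.sum_boole, Λcount, Nat.card_eq_fintype_card, Fintype.card_subtype]

end

section

variable {F : Type} [Field F] {k m n : ℕ} {s : Fin k → ℕ} {nn : Fin k → ℕ → ℕ}

/-- The subspaces attached to the vertices of the star-shaped quiver by a family of flags. -/
def flagSubspace (V : ∀ i, Flag F n (legβ k s nn i)) : StarV k s → Submodule F (Fin n → F)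
  | none => ⊤
  | some a => (V a.1).1 (a.2.1 + 1)

theorem flagSubspace_stable (V : ∀ i, Flag F n (legβ k s nn i)) {g : GL (Fin n) F}
    (hg : ∀ i, (V i).IsStable g) (v : StarV k s) :
    ∀ x ∈ flagSubspace V v,
      Matrix.mulVecLin (g : Matrix (Fin n) (Fin n) F) x ∈ flagSubspace V v := by
  rcases v with _ | a
  · exact fun _ _ => Submodule.mem_top
  · exact hg a.1 _

theorem flagSubspace_le_legPrev (V : ∀ i, Flag F n (legβ k s nn i)) (a : (i : Fin k) × Fin (s i)) :
    flagSubspace V (some a) ≤ flagSubspace V (legPrev k s a) := by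
  unfold legPrev
  split_ifs with h
  · exact le_top
  · change (V a.1).1 (a.2.1 + 1) ≤ (V a.1).1 (a.2.1 - 1 + 1)
    rw [Nat.sub_add_cancel (Nat.one_le_iff_ne_zero.2 h)]
    exact (V a.1).2.2.1 _

theorem finrank_flagSubspace (V : ∀ i, Flag F n (legβ k s nn i)) (v : StarV k s) :
    Module.finrank F (flagSubspace V v) = starα k n s nn v := by
  rcases v with _ | a
  · rw [flagSubspace, starα, finrank_top, Module.finrank_fin_fun]
  · exact (V a.1).2.2.2 _

theorem legβ_eq_zero (i : Fin k) {j : ℕ} (hj : s i < j) : legβ k s nn i j = 0 := by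
  rw [legβ, Finset.Icc_eq_empty (by lia), Finset.sum_empty]

theorem prod_prod_χap_quotDet (V : ∀ i, Flag F n (legβ k s nn i)) (γ : Fin k → ℕ → (Fˣ →* ℂˣ))
    {g : GL (Fin n) F} (hg : ∀ i, (V i).IsStable g) :
    ∏ i, ∏ j ∈ Finset.range (s i + 1),
        χap (γ i j) (quotDet (Matrix.mulVecLin (g : Matrix (Fin n) (Fin n) F))
          ((V i).1 j) ((V i).1 (j + 1))) =
      ∏ v, χap (starσ F k s γ v)
        (restrictDet (Matrix.mulVecLin (g : Matrix (Fin n) (Fin n) F)) (flagSubspace V v)) := by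
  have hd := restrictDet_ne_zero (W := ⊤) (det_mulVecLin_ne_zero g) fun _ _ => Submodule.mem_top
  rw [Finset.prod_congr rfl fun i _ =>
      (V i).prod_χap_quotDet (legβ_eq_zero i (Nat.lt_succ_self _)) (γ i) (hg i),
    Finset.prod_mul_distrib, Fintype.prod_option, Fintype.prod_sigma]
  congr 1
  · simp only [starσ, flagSubspace]
    have := prod_χap_pow (fun i => γ i 0) (fun _ => 1) hd
    refine (Finset.prod_congr rfl fun i _ => by rw [pow_one]).trans (this.trans ?_)
    exact congrArg (χap · _) (Finset.prod_congr rfl fun i _ => MonoidHom.ext fun x => by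
      rw [MonoidHom.pow_apply, pow_one])
  · exact Finset.prod_congr rfl fun i _ => Finset.prod_range _

/-- The invertible matrices commuting with the matrices `A` and preserving the flags `V`. -/
def flagSubmonoid (A : Fin m → Matrix (Fin n) (Fin n) F)
    (V : ∀ i, Flag F n (legβ k s nn i)) : Submonoid (GL (Fin n) F) where
  carrier := {g | (∀ r, (g : Matrix (Fin n) (Fin n) F) * A r = A r * g) ∧ ∀ i, (V i).IsStable g}
  one_mem' := ⟨fun r => by simp, fun i j v hv => by simpa using hv⟩
  mul_mem' := by
    rintro g h ⟨hgA, hgV⟩ ⟨hhA, hhV⟩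
    refine ⟨fun r => ?_, fun i j v hv => ?_⟩
    · rw [Units.val_mul, Matrix.mul_assoc, hhA, ← Matrix.mul_assoc, hgA, Matrix.mul_assoc]
    · rw [Units.val_mul, Matrix.mulVecLin_mul]
      exact hgV i j _ (hhV i j v hv)

/-- The automorphism group of the representation consisting of the matrices `A` and the
flags `V`. -/
def flagStabilizer [Finite F] (A : Fin m → Matrix (Fin n) (Fin n) F)
    (V : ∀ i, Flag F n (legβ k s nn i)) : Subgroup (GL (Fin n) F) where
  __ := flagSubmonoid A V
  inv_mem' := by
    intro g hg
    obtain ⟨e, he⟩ := (isOfFinOrder_of_finite g).mem_powers_iff_mem_zpowers.2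
      (inv_mem (Subgroup.mem_zpowers g))
    rw [← he]
    exact (flagSubmonoid A V).pow_mem hg e

/-- The linear character of `flagStabilizer A V` determined by `σ`. -/
noncomputable def flagCharacter [Finite F] (A : Fin m → Matrix (Fin n) (Fin n) F)
    (V : ∀ i, Flag F n (legβ k s nn i)) (σ : StarV k s → (Fˣ →* ℂˣ)) :
    flagStabilizer A V →* ℂ where
  toFun g := ∏ v, χap (σ v)
    (restrictDet (Matrix.mulVecLin (g.1 : Matrix (Fin n) (Fin n) F)) (flagSubspace V v))
  map_one' := by
    refine Finset.prod_eq_one fun v _ => ?_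
    rw [← χap_one_right (σ v), ← restrictDet_one (flagSubspace V v)]
    congr
    simp
    rfl
  map_mul' g h := by
    rw [← Finset.prod_mul_distrib]
    refine Finset.prod_congr rfl fun v _ => ?_
    rw [← χap_mul_right, ← restrictDet_mul _ _ _ (flagSubspace_stable V g.2.2 v)
      (flagSubspace_stable V h.2.2 v)]
    congr
    simp
    rfl

theorem flagCharacter_apply [Finite F] (A : Fin m → Matrix (Fin n) (Fin n) F)
    (V : ∀ i, Flag F n (legβ k s nn i)) (σ : StarV k s → (Fˣ →* ℂˣ)) (g : flagStabilizer A V) :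
    flagCharacter A V σ g = ∏ v, χap (σ v)
      (restrictDet (Matrix.mulVecLin (g.1 : Matrix (Fin n) (Fin n) F)) (flagSubspace V v)) :=
  rfl

theorem mulVecLin_aeval (B : Matrix (Fin n) (Fin n) F) (f : F[X]) :
    Matrix.mulVecLin (aeval B f) = aeval (Matrix.mulVecLin B) f :=
  (aeval_algHom_apply (Matrix.toLinAlgEquiv' (R := F) (n := Fin n)).toAlgHom B f).symm

theorem exists_mem_flagStabilizer_aeval [Finite F] (A : Fin m → Matrix (Fin n) (Fin n) F)
    (V : ∀ i, Flag F n (legβ k s nn i)) {g : GL (Fin n) F} (hg : g ∈ flagStabilizer A V)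
    (f : F[X])
    (hf : LinearMap.det (aeval (Matrix.mulVecLin (g : Matrix (Fin n) (Fin n) F)) f) ≠ 0) :
    ∃ h ∈ flagStabilizer A V, Matrix.mulVecLin (h : Matrix (Fin n) (Fin n) F) =
      aeval (Matrix.mulVecLin (g : Matrix (Fin n) (Fin n) F)) f := by
  have hdet : (aeval (g : Matrix (Fin n) (Fin n) F) f).det ≠ 0 := by
    rw [← LinearMap.det_toLin', Matrix.toLin'_apply', mulVecLin_aeval]
    exact hf
  refine ⟨Matrix.GeneralLinearGroup.mkOfDetNeZero _ hdet, ⟨fun r => ?_, fun i j => ?_⟩,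
    mulVecLin_aeval _ f⟩
  · change aeval (g : Matrix (Fin n) (Fin n) F) f * A r =
      A r * aeval (g : Matrix (Fin n) (Fin n) F) f
    have : aeval (g : Matrix (Fin n) (Fin n) F) f ∈ Subalgebra.centralizer F {A r} :=
      Algebra.adjoin_le (Set.singleton_subset_iff.2
        (Subalgebra.mem_centralizer_iff F |>.2 (by simpa using (hg.1 r).symm)))
        (aeval_mem_adjoin_singleton F _)
    exact ((Subalgebra.mem_centralizer_iff F).1 this _ rfl).symm
  · change ∀ v ∈ (V i).1 j, Matrix.mulVecLin (aeval (g : Matrix (Fin n) (Fin n) F) f) v ∈ _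
    rw [mulVecLin_aeval]
    exact aeval_mem _ _ (hg.2 i j) f

theorem flagCharacter_eq_one [Finite F] (A : Fin m → Matrix (Fin n) (Fin n) F)
    (V : ∀ i, Flag F n (legβ k s nn i)) {σ σ' : StarV k s → (Fˣ →* ℂˣ)}
    (hσ : ∀ δ : StarV k s → ℕ, NonIncr k s δ → δ ≠ 0 → (∀ v, δ v ≤ starα k n s nn v) →
      ∏ v, σ v ^ δ v = 1 → ∏ v, σ' v ^ δ v = 1)
    (h1 : flagCharacter A V σ = 1) : flagCharacter A V σ' = 1 := by
  ext g
  rw [flagCharacter_apply, MonoidHom.one_apply]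
  have hst := flagSubspace_stable V g.2.2
  refine prod_χap_restrictDet_eq_one _ (det_mulVecLin_ne_zero g.1) _ hst σ σ'
    (fun p hp => hσ _ (fun a => ?_) (fun h0 => ?_) fun v => ?_) fun f hf => ?_
  · exact restrictMult_mono _ (flagSubspace_le_legPrev V a) (hst _) (hst _) p
  · exact restrictMult_top_ne_zero _ hp (congrFun h0 none)
  · rw [← finrank_flagSubspace V v]
    exact restrictMult_le_finrank _ _ (UniqueFactorizationMonoid.irreducible_of_normalized_factor _ hp)
  · obtain ⟨h, hh, he⟩ := exists_mem_flagStabilizer_aeval A V g.2 f hf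
    have h1h := DFunLike.congr_fun h1 (⟨h, hh⟩ : flagStabilizer A V)
    rw [flagCharacter_apply, MonoidHom.one_apply] at h1h
    rw [← he]
    exact h1h

theorem mult_eq_sum_flagCharacter [Fintype F] [∀ i, Fintype (Flag F n (legβ k s nn i))]
    (γ : Fin k → ℕ → (Fˣ →* ℂˣ)) :
    mult F k m n s nn γ = (Nat.card (GL (Fin n) F) : ℂ)⁻¹ *
      ∑ A : Fin m → Matrix (Fin n) (Fin n) F, ∑ V : ∀ i, Flag F n (legβ k s nn i),
        ∑ g : flagStabilizer A V, flagCharacter A V (starσ F k s γ) g := by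
  rw [mult, finsum_eq_sum_of_fintype]
  congr 1
  simp only [HC_eq_sum, Finset.prod_univ_sum, Fintype.piFinset_univ, Fintype.prod_ite_zero,
    Λcount_eq_sum, Finset.sum_mul]
  rw [Finset.sum_comm]
  refine Finset.sum_congr rfl fun A _ => ?_
  simp only [Finset.mul_sum]
  rw [Finset.sum_comm]
  refine Finset.sum_congr rfl fun V _ => ?_
  simp only [ite_mul, one_mul, zero_mul, ← ite_and]
  symm
  rw [Finset.sum_congr rfl fun (g : flagStabilizer A V) _ =>
      (flagCharacter_apply A V _ g).trans (prod_prod_χap_quotDet V γ g.2.2).symm,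
    ← Finset.sum_subtype (Finset.univ.filter (· ∈ flagStabilizer A V)) (by simp)
      fun g => ∏ i, ∏ j ∈ Finset.range (s i + 1),
        χap (γ i j) (quotDet (Matrix.mulVecLin (g : Matrix (Fin n) (Fin n) F))
          ((V i).1 j) ((V i).1 (j + 1))), Finset.sum_filter]
  refine Finset.sum_congr rfl fun g _ => ?_
  by_cases hg : g ∈ flagStabilizer A V
  · rw [if_pos hg]
    exact (if_pos hg).symm
  · rw [if_neg hg]
    exact (if_neg hg).symm

end

end QRep

end

open QRep in
/-- If two families of characters `γ`, `γ'` (for the same block sizes)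
have `H*_{σ,α} = H*_{σ',α}`, then the corresponding multiplicities agree: the
multiplicity depends on the characters only through the set `H*_{σ,α}`. -/
theorem statement9 (F : Type) [Field F] [Fintype F] (k m n : ℕ) (hk : 1 ≤ k) (hn : 1 ≤ n)
    (s : Fin k → ℕ) (nn : Fin k → ℕ → ℕ) (hsum : ∀ i, legβ k s nn i 0 = n)
    (γ γ' : Fin k → ℕ → (Fˣ →* ℂˣ))
    (hH : ∀ δ : StarV k s → ℕ, NonIncr k s δ → δ ≠ 0 →
      (∀ v, δ v ≤ starα k n s nn v) →
      (∏ v, (starσ F k s γ v) ^ (δ v) = 1 ↔ ∏ v, (starσ F k s γ' v) ^ (δ v) = 1)) :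
    mult F k m n s nn γ = mult F k m n s nn γ' := by
  have (i : Fin k) : Finite (Flag F n (legβ k s nn i)) := Flag.finite fun j => legβ_eq_zero i
  have (i : Fin k) : Fintype (Flag F n (legβ k s nn i)) := Fintype.ofFinite _
  classical
  rw [mult_eq_sum_flagCharacter, mult_eq_sum_flagCharacter]
  refine congrArg _ (Finset.sum_congr rfl fun A _ => Finset.sum_congr rfl fun V _ => ?_)
  have hiff : flagCharacter A V (starσ F k s γ) = 1 ↔ flagCharacter A V (starσ F k s γ') = 1 :=
    ⟨flagCharacter_eq_one A V fun δ h1 h2 h3 => (hH δ h1 h2 h3).1,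
      flagCharacter_eq_one A V fun δ h1 h2 h3 => (hH δ h1 h2 h3).2⟩
  simp only [sum_hom_units, hiff]
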